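/- (Theorem 1) Let h, φ : ℝ → ℝ and u, p : ℝ → ℝ² be differentiable, where for every t the hyperbolic-number identity (ḣ(t) + j h(t) φ̇(t))·p(t) = u̇(t) + j φ̇(t)·u(t) holds, and define the fixed pole curve p'(t) = (h(t)·p(t) − u(t))·e^{jφ(t)}. Then for every t the hyperbolic arc elements satisfy ‖ṗ'(t)‖ₕ = |h(t)| · ‖ṗ(t)‖ₕ; that is, ds' = |h| ds, so the moving pole curve rolls on the fixed pole curve with sliding coefficient equal to the homothetic scale h (and in the special case h ≡ 1 they roll on each other without sliding, ds' = ds). -/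

import Mathlib

/-- Hyperbolic (split-complex) numbers, identified with pairs of reals:
`z = z₁ + j z₂ ↔ (z₁, z₂)`. -/
abbrev Hyp : Type := ℝ × ℝ

/-- The hyperbolic-number product:
`(z₁ + j z₂)(w₁ + j w₂) = (z₁w₁ + z₂w₂) + j (z₁w₂ + z₂w₁)`. -/
def hmul (z w : Hyp) : Hyp := (z.1 * w.1 + z.2 * w.2, z.1 * w.2 + z.2 * w.1)

/-- The hyperbolic imaginary unit `j`. -/
def jh : Hyp := (0, 1)

/-- The hyperbolic exponential `e^{jφ} = cosh φ + j sinh φ`. -/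
noncomputable def hexp (φ : ℝ) : Hyp := (Real.cosh φ, Real.sinh φ)

/-- The hyperbolic modulus `‖z‖ₕ = √|z₁² − z₂²|`. -/
noncomputable def hnorm (z : Hyp) : ℝ := Real.sqrt |z.1 ^ 2 - z.2 ^ 2|

/-- The hyperbolic inner product `⟨z, w⟩ = z₁w₁ − z₂w₂`. -/
def hinner (z w : Hyp) : ℝ := z.1 * w.1 - z.2 * w.2

theorem hnorm_hmul (z w : Hyp) : hnorm (hmul z w) = hnorm z * hnorm w := by
  simp only [hnorm, hmul]
  rw [← Real.sqrt_mul (abs_nonneg _), ← abs_mul]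
  congr 2
  ring

theorem hnorm_hexp (φ : ℝ) : hnorm (hexp φ) = 1 := by
  simp [hnorm, hexp, Real.cosh_sq_sub_sinh_sq]

theorem hnorm_smul (c : ℝ) (z : Hyp) : hnorm (c • z) = |c| * hnorm z := by
  simp only [hnorm, Prod.smul_fst, Prod.smul_snd, smul_eq_mul]
  rw [← Real.sqrt_sq (abs_nonneg c), ← Real.sqrt_mul (sq_nonneg _), ← abs_pow, ← abs_mul]
  congr 2
  ring

theorem HasDerivAt.hmul {f g : ℝ → Hyp} {f' g' : Hyp} {t : ℝ}
    (hf : HasDerivAt f f' t) (hg : HasDerivAt g g' t) :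
    HasDerivAt (fun s => _root_.hmul (f s) (g s))
      (_root_.hmul f' (g t) + _root_.hmul (f t) g') t := by
  have hf₁ : HasDerivAt (fun s => (f s).1) f'.1 t := by
    simpa using (HasFDerivAt.fst hf.hasFDerivAt).hasDerivAt
  have hf₂ : HasDerivAt (fun s => (f s).2) f'.2 t := by
    simpa using (HasFDerivAt.snd hf.hasFDerivAt).hasDerivAt
  have hg₁ : HasDerivAt (fun s => (g s).1) g'.1 t := by
    simpa using (HasFDerivAt.fst hg.hasFDerivAt).hasDerivAt
  have hg₂ : HasDerivAt (fun s => (g s).2) g'.2 t := by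
    simpa using (HasFDerivAt.snd hg.hasFDerivAt).hasDerivAt
  refine (((hf₁.mul hg₁).add (hf₂.mul hg₂)).prodMk
    ((hf₁.mul hg₂).add (hf₂.mul hg₁))).congr_deriv ?_
  ext <;> simp only [_root_.hmul, Prod.fst_add, Prod.snd_add] <;> ring

theorem HasDerivAt.hexp {φ : ℝ → ℝ} {φ' t : ℝ} (hφ : HasDerivAt φ φ' t) :
    HasDerivAt (fun s => _root_.hexp (φ s)) (_root_.hmul (0, φ') (_root_.hexp (φ t))) t := by
  refine (hφ.cosh.prodMk hφ.sinh).congr_deriv ?_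
  ext <;> simp only [_root_.hmul, _root_.hexp] <;> ring

/-- The pole condition cancels every term of the velocity of the fixed pole curve except
the one coming from the motion of the pole along the moving pole curve. -/
theorem hasDerivAt_fixed_pole {h φ : ℝ → ℝ} {u p : ℝ → Hyp} {h' φ' t : ℝ} {u' q : Hyp}
    (hh : HasDerivAt h h' t) (hφ : HasDerivAt φ φ' t)
    (hu : HasDerivAt u u' t) (hp : HasDerivAt p q t)
    (hpole : hmul (h', h t * φ') (p t) = u' + hmul (0, φ') (u t)) :
    HasDerivAt (fun s => hmul (h s • p s - u s) (hexp (φ s)))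
      (hmul (h t • q) (hexp (φ t))) t := by
  refine (((hh.smul hp).sub hu).hmul hφ.hexp).congr_deriv ?_
  have h₁ := congrArg Prod.fst hpole
  have h₂ := congrArg Prod.snd hpole
  simp only [hmul, Prod.fst_add, Prod.snd_add] at h₁ h₂
  ext <;> simp only [hmul, hexp, Pi.sub_apply, Pi.smul_apply', Prod.fst_add, Prod.snd_add,
    Prod.fst_sub, Prod.snd_sub, Prod.smul_fst, Prod.smul_snd, smul_eq_mul]
  · linear_combination Real.cosh (φ t) * h₁ + Real.sinh (φ t) * h₂
  · linear_combination Real.sinh (φ t) * h₁ + Real.cosh (φ t) * h₂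

/-- **Theorem 1.** The arc elements of the fixed and moving pole
curves satisfy `ds' = |h| ds`, i.e. `‖ṗ'(t)‖ₕ = |h t| ‖ṗ(t)‖ₕ`: the moving pole
curve rolls by sliding on the fixed one, with sliding coefficient the
homothetic scale `h` (for `h ≡ 1` they roll without sliding, `ds' = ds`). -/
theorem pole_curves_arc_elements
    (h φ : ℝ → ℝ) (u p : ℝ → Hyp)
    (hh : Differentiable ℝ h) (hφ : Differentiable ℝ φ)
    (hu : Differentiable ℝ u) (hp : Differentiable ℝ p)
    (hpole : ∀ t, hmul (deriv h t, h t * deriv φ t) (p t)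
      = deriv u t + hmul (0, deriv φ t) (u t))
    (p' : ℝ → Hyp)
    (hp' : ∀ t, p' t = hmul (h t • p t - u t) (hexp (φ t))) :
    ∀ t, hnorm (deriv p' t) = |h t| * hnorm (deriv p t) := by
  intro t
  obtain rfl : p' = fun s => hmul (h s • p s - u s) (hexp (φ s)) := funext hp'
  rw [(hasDerivAt_fixed_pole (hh t).hasDerivAt (hφ t).hasDerivAt (hu t).hasDerivAt
    (hp t).hasDerivAt (hpole t)).deriv, hnorm_hmul, hnorm_hexp, mul_one, hnorm_smul]
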